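/- arXiv:1702.03179 — 4 statements merged into one kernel-verified Lean document; each statement's English description precedes it below -/
import Mathlib

section
/- Let G be a finite group, q a prime, and χ an irreducible complex character of G of q-defect zero, i.e. q does not divide |G|/χ(1). Then χ(g)=0 for every element g of G whose order is divisible by q. -/
/-- `x` is a vanishing element of `G`: some irreducible complex character of `G`
(character of a simple finite-dimensional complex representation) vanishes at `x`. -/
def IsVanishing (G : Type) [Group G] (x : G) : Prop :=
  ∃ V : FDRep ℂ G, CategoryTheory.Simple V ∧ V.character x = 0

/-- The size of the conjugacy class of `x`. -/
noncomputable def classSize {G : Type*} [Group G] (x : G) : ℕ :=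
  Nat.card {y : G // IsConj x y}

/-- `x` has prime power order. -/
def HasPrimePowerOrder {G : Type*} [Group G] (x : G) : Prop :=
  ∃ p k : ℕ, p.Prime ∧ orderOf x = p ^ k

namespace DZ

open CategoryTheory

theorem schur {G : Type} [Group G] (V : FDRep ℂ G) (hV : Simple V) (T : V →ₗ[ℂ] V)
    (hT : ∀ g, T ∘ₗ V.ρ g = V.ρ g ∘ₗ T) : ∃ c : ℂ, T = c • LinearMap.id := by
  let f : V ⟶ V := ⟨InducedCategory.homMk (ModuleCat.ofHom T), fun g ↦ by
    ext x; exact LinearMap.congr_fun (hT g) x⟩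
  obtain ⟨c, hc⟩ := endomorphism_simple_eq_smul_id ℂ f
  refine ⟨c, ?_⟩
  have : (c • (𝟙 V : V ⟶ V)).hom.hom.hom = f.hom.hom.hom := by rw [hc]
  exact this.symm

theorem char_integral {G : Type} [Group G] [Fintype G] (V : FDRep ℂ G) (g : G) :
    IsIntegral ℤ (V.character g) := by
  have h := Module.End.trace_eq_sum_roots_charpoly_of_splits (f := V.ρ g) (IsAlgClosed.splits _)
  rw [FDRep.character, h]
  apply IsIntegral.multiset_sum
  intro x hx
  have hx' : (V.ρ g).charpoly.IsRoot x := Polynomial.isRoot_of_mem_roots hx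
  rw [← Module.End.hasEigenvalue_iff_isRoot_charpoly] at hx'
  have h1 := hx'.pow (Fintype.card G)
  rw [← map_pow, pow_card_eq_one, map_one] at h1
  obtain ⟨v, hv⟩ := h1.exists_hasEigenvector
  have h2 := hv.apply_eq_smul
  have h3 : x ^ Fintype.card G = 1 := by
    by_contra hne
    have : (1 - x ^ Fintype.card G) • v = 0 := by
      rw [sub_smul, ← h2]; simp
    rcases smul_eq_zero.1 this with h | h
    · exact hne (sub_eq_zero.1 h).symm
    · exact hv.2 h
  exact IsIntegral.of_pow Fintype.card_pos (h3 ▸ isIntegral_one)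

theorem sum_char {G : Type} [Group G] [Fintype G] (V : FDRep ℂ G) (hV : Simple V) :
    ∑ h : G, V.character h * V.character h⁻¹ = Fintype.card G := by
  classical
  have : Invertible (Nat.card G : ℂ) := invertibleOfNonzero (by simp)
  have := FDRep.char_orthonormal V V
  rw [if_pos ⟨Iso.refl V⟩] at this
  have h0 : (Nat.card G : ℂ) ≠ 0 := by simp
  field_simp at this
  simpa using this

theorem conv {G : Type} [Group G] [Fintype G] (V : FDRep ℂ G) (hV : Simple V) (k : G) :
    (Module.finrank ℂ V : ℂ) * ∑ h : G, V.character h⁻¹ * V.character (h * k) =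
      Fintype.card G * V.character k := by
  set T : V →ₗ[ℂ] V := ∑ h : G, V.character h⁻¹ • V.ρ h with hTdef
  have hT : ∀ g, T ∘ₗ V.ρ g = V.ρ g ∘ₗ T := by
    intro g
    change T * V.ρ g = V.ρ g * T
    rw [hTdef, Finset.sum_mul, Finset.mul_sum]
    refine Fintype.sum_equiv (MulAut.conj g⁻¹).toEquiv _ _ fun h => ?_
    simp only [MulEquiv.toEquiv_eq_coe, MulEquiv.coe_toEquiv, MulAut.conj_apply, inv_inv,
      smul_mul_assoc, mul_smul_comm, ← map_mul]
    congr 1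
    · rw [show (g⁻¹ * h * g)⁻¹ = g⁻¹ * h⁻¹ * g⁻¹⁻¹ by group, FDRep.char_conj]
    · congr 1; group
  obtain ⟨c, hc⟩ := schur V hV T hT
  have h1 : ∀ k, ∑ h : G, V.character h⁻¹ * V.character (h * k) = c * V.character k := by
    intro k
    have : LinearMap.trace ℂ V (T * V.ρ k) = c * V.character k := by
      have h0 : T * V.ρ k = c • V.ρ k := by rw [hc]; rfl
      rw [h0, map_smul, smul_eq_mul, FDRep.character]
    rw [← this, hTdef, Finset.sum_mul, map_sum]
    simp [FDRep.character, ← map_mul]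
  have h2 := h1 1
  have h3 := sum_char V hV
  rw [h1 k]
  simp only [mul_one, FDRep.char_one] at h2
  simp_rw [mul_comm] at h3 h2
  rw [h3] at h2
  rw [h2]; ring

theorem finrank_pos {G : Type} [Group G] [Fintype G] (V : FDRep ℂ G) (hV : Simple V) :
    0 < Module.finrank ℂ V := by
  rcases Nat.eq_zero_or_pos (Module.finrank ℂ V) with h | h
  · exfalso
    have := conv V hV 1
    rw [FDRep.char_one, h] at this
    have h3 := sum_char V hV
    have : ∀ g, V.character g = 0 := by
      intro g
      have := conv V hV g
      rw [h] at this
      simpa using this.symm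
    simp [this] at h3
    exact Fintype.card_ne_zero (α := G) (by exact_mod_cast h3.symm)
  · exact h

theorem dvd_card {G : Type} [Group G] [Fintype G] (V : FDRep ℂ G) (hV : Simple V) :
    Module.finrank ℂ V ∣ Fintype.card G := by
  have hn := finrank_pos V hV
  set n := Module.finrank ℂ V with hndef
  have hn0 : (n : ℂ) ≠ 0 := by exact_mod_cast hn.ne'
  let A := integralClosure ℤ ℂ
  let N : Submodule A ℂ := Submodule.span A (Set.range V.character)
  have hint : IsIntegral A ((Fintype.card G : ℂ) / n) := by
    refine isIntegral_of_smul_mem_submodule N ?_ ?_ _ ?_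
    · intro h
      have : V.character 1 ∈ N := Submodule.subset_span ⟨1, rfl⟩
      rw [h, Submodule.mem_bot, FDRep.char_one] at this
      exact hn0 this
    · exact Submodule.fg_span (Set.finite_range _)
    · intro x hx
      induction hx using Submodule.span_induction with
      | zero => simp
      | add x y _ _ hx hy => rw [smul_add]; exact N.add_mem hx hy
      | smul a x _ hx => rw [smul_comm]; exact N.smul_mem a hx
      | mem x hx =>
        obtain ⟨k, rfl⟩ := hx
        have : ((Fintype.card G : ℂ) / n) • V.character k =
            ∑ h : G, V.character h⁻¹ * V.character (h * k) := by
          rw [smul_eq_mul, div_mul_eq_mul_div, ← conv V hV k, mul_div_cancel_left₀ _ hn0]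
        rw [this]
        refine N.sum_mem fun h _ => ?_
        exact N.smul_mem (⟨V.character h⁻¹, char_integral V _⟩ : A)
          (Submodule.subset_span ⟨h * k, rfl⟩)
  have hint2 : IsIntegral ℤ ((Fintype.card G : ℂ) / n) := isIntegral_trans _ hint
  have hint3 : IsIntegral ℤ ((Fintype.card G : ℚ) / n) := by
    rw [← isIntegral_algebraMap_iff (algebraMap ℚ ℂ).injective]
    simpa using hint2
  obtain ⟨z, hz⟩ := IsIntegrallyClosed.isIntegral_iff.1 hint3
  have hq : (n : ℚ) ≠ 0 := by exact_mod_cast hn.ne'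
  rw [eq_div_iff hq] at hz
  have : (Fintype.card G : ℤ) = n * z := by
    have : (Fintype.card G : ℚ) = ((n * z : ℤ) : ℚ) := by
      rw [← hz]; push_cast; simp [mul_comm]
    exact_mod_cast this
  exact Int.natCast_dvd_natCast.1 ⟨z, this⟩

theorem trace_eq {ι R : Type*} [Fintype ι] [DecidableEq ι] [CommRing R] [IsLocalRing R]
    (E F L : Matrix ι ι R) (hE : E * E = E) (hF : F * F = F)
    (hEF : E.map (IsLocalRing.residue R) = F.map (IsLocalRing.residue R))
    (hLE : L * E = E * L) (hLF : L * F = F * L) : (L * E).trace = (L * F).trace := by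
  set U := E * F + (1 - E) * (1 - F) with hU
  have hU1 : (IsLocalRing.residue R).mapMatrix U = 1 := by
    have e1 : (IsLocalRing.residue R).mapMatrix E = (IsLocalRing.residue R).mapMatrix F := hEF
    have e2 := congrArg (IsLocalRing.residue R).mapMatrix hF
    rw [map_mul] at e2
    rw [hU, map_add, map_mul, map_mul, map_sub, map_sub, map_one, e1]
    simp only [mul_sub, sub_mul, one_mul, mul_one, e2]
    abel
  have hdet : IsUnit U.det := by
    rw [← IsLocalRing.residue_ne_zero_iff_isUnit, RingHom.map_det, hU1]
    simp
  have hUU : IsUnit U := (Matrix.isUnit_iff_isUnit_det U).2 hdet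
  obtain ⟨u, hu⟩ := hUU
  have h1 : E * U = U * F := by
    rw [hU]
    simp only [mul_add, add_mul, mul_sub, sub_mul, one_mul, mul_one, ← mul_assoc, hE]
    simp only [mul_assoc, hF]
    abel
  have h2 : L * U = U * L := by
    have a1 : L * (E * F) = E * F * L := by rw [← mul_assoc, hLE, mul_assoc, hLF, mul_assoc]
    rw [hU]
    simp only [mul_add, add_mul, mul_sub, sub_mul, one_mul, mul_one, a1, hLE, hLF]
  have hE' : E = u * F * (↑u⁻¹ : Matrix ι ι R) := by
    rw [hu, ← h1, ← hu, Units.mul_inv_cancel_right]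
  have : L * E = u * (L * F) * (↑u⁻¹ : Matrix ι ι R) := by
    rw [hE', ← mul_assoc, ← mul_assoc, hu, h2, mul_assoc U L F]
  rw [this, Matrix.trace_units_conj]

theorem exists_val (q : ℕ) (hq : q.Prime) :
    ∃ O : ValuationSubring ℂ, ((q : ℕ) : IsLocalRing.ResidueField O) = 0 := by
  let A : Subring ℂ := (algebraMap ℤ ℂ).range
  let e : ℤ ≃+* A := RingEquiv.ofBijective (algebraMap ℤ ℂ).rangeRestrict
    ⟨fun a b h => by
      have := congrArg Subtype.val h
      simpa using this, RingHom.rangeRestrict_surjective _⟩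
  let I : Ideal A := Ideal.span {(q : A)}
  have hI : I ≠ ⊤ := by
    intro h
    have h1 : IsUnit (q : A) := Ideal.span_singleton_eq_top.1 h
    have h2 := h1.map e.symm
    rw [map_natCast] at h2
    have h3 := Int.isUnit_iff_natAbs_eq.1 h2
    simp at h3
    exact hq.one_lt.ne' h3
  obtain ⟨O, -, hO⟩ := I.image_subset_nonunits_valuationSubring hI
  refine ⟨O, ?_⟩
  have h1 : (q : ℂ) ∈ O.nonunits := hO ⟨(q : A), Ideal.subset_span rfl, by simp⟩
  rw [← map_natCast (IsLocalRing.residue O), IsLocalRing.residue_eq_zero_iff]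
  obtain ⟨h, h'⟩ := ValuationSubring.mem_nonunits_iff_exists_mem_maximalIdeal.1 h1
  convert h' using 1
  exact Subtype.ext (by simp)

theorem exists_twist {G M : Type*} [Group G] [CommGroup M] (g : G) (ζ : M)
    (h : orderOf ζ ∣ orderOf g) (q : ℕ) (hζ : ζ ^ q = 1) :
    ∃ f : G → M, (∀ x, f (g * x) = ζ * f x) ∧ ∀ x, f x ^ q = 1 := by
  let H := Subgroup.zpowers g
  let γ : H := ⟨g, Subgroup.mem_zpowers g⟩
  have hγ : ∀ x : H, x ∈ Subgroup.zpowers γ := by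
    rintro ⟨x, k, rfl⟩
    exact ⟨k, by ext; simp [γ]⟩
  let μ : H →* M := monoidHomOfForallMemZpowers hγ (g' := ζ) (by
    rw [← Subgroup.orderOf_coe]; exact h)
  have hμ : μ γ = ζ := monoidHomOfForallMemZpowers_apply_gen hγ _
  let rep : G → G := fun x => (Quotient.mk (QuotientGroup.rightRel H) x).out
  have hrep : ∀ x, x * (rep x)⁻¹ ∈ H := fun x =>
    QuotientGroup.rightRel_apply.1 (Quotient.mk_out (s := QuotientGroup.rightRel H) x)
  have hrep2 : ∀ x, rep (g * x) = rep x := fun x => by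
    have : (Quotient.mk (QuotientGroup.rightRel H) (g * x)) = Quotient.mk _ x := by
      apply Quotient.sound
      apply QuotientGroup.rightRel_apply.2
      simp [H]
    simp only [rep, this]
  refine ⟨fun x => μ ⟨_, hrep x⟩, fun x => ?_, fun x => ?_⟩
  · rw [← hμ, ← map_mul]
    refine congrArg μ (Subtype.ext ?_)
    simp [γ, hrep2, mul_assoc]
  · obtain ⟨k, hk⟩ := hγ ⟨_, hrep x⟩
    simp only at hk ⊢
    rw [← hk, map_zpow, hμ, ← zpow_natCast, zpow_comm, zpow_natCast, hζ, one_zpow]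

theorem main (G : Type) [Group G] [Fintype G] (q : ℕ) (hq : q.Prime)
    (V : FDRep ℂ G) (hV : CategoryTheory.Simple V)
    (hdef : ¬ q ∣ Fintype.card G / Module.finrank ℂ V) (g : G) (hg : q ∣ orderOf g) :
    V.character g = 0 := by
  classical
  obtain ⟨m, hm⟩ := dvd_card V hV
  have hn := finrank_pos V hV
  have hcv := conv V hV
  set n := Module.finrank ℂ V with hndef
  have hn0 : (n : ℂ) ≠ 0 := by exact_mod_cast hn.ne'
  rw [hm, Nat.mul_div_cancel_left _ hn] at hdef
  have hcv' : ∀ k, ∑ h : G, V.character h⁻¹ * V.character (h * k) = m * V.character k := by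
    intro k
    have := hcv k
    rw [hm] at this
    push_cast at this
    rw [mul_assoc] at this
    exact mul_left_cancel₀ hn0 this
  obtain ⟨O, hO⟩ := exists_val q hq
  have : Fact q.Prime := ⟨hq⟩
  have : CharP (IsLocalRing.ResidueField O) q :=
    (CharP.charP_iff_prime_eq_zero hq).2 hO
  have hmem : ∀ x : ℂ, IsIntegral ℤ x → x ∈ O := by
    intro x hx
    have h1 : IsIntegral O x := hx.tower_top
    obtain ⟨y, rfl⟩ := IsIntegrallyClosed.isIntegral_iff.1 h1
    exact y.2
  have hmu : IsUnit (m : O) := by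
    rw [← IsLocalRing.residue_ne_zero_iff_isUnit, map_natCast]
    rwa [Ne, CharP.cast_eq_zero_iff _ q]
  obtain ⟨mu, hmu⟩ := hmu
  let χ : G → O := fun x => ⟨V.character x, hmem _ (char_integral V x)⟩
  have hχ : ∀ k, ∑ h : G, χ h⁻¹ * χ (h * k) = m * χ k := by
    intro k
    apply Subtype.val_injective
    have := hcv' k
    simpa [χ] using this
  have hχconj : ∀ x y, χ (x * y) = χ (y * x) := fun x y =>
    Subtype.ext (FDRep.char_mul_comm V y x)
  -- root of unity
  have hζ0 := Complex.isPrimitiveRoot_exp q hq.ne_zero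
  set ζ0 := Complex.exp (2 * Real.pi * Complex.I / q)
  let ζ1 : O := ⟨ζ0, hmem _ (hζ0.isIntegral hq.pos)⟩
  have hζ1 : IsPrimitiveRoot ζ1 q :=
    IsPrimitiveRoot.of_map_of_injective (f := O.subtype) hζ0 Subtype.val_injective
  let ζ : Oˣ := (hζ1.isUnit hq.ne_zero).unit
  have hζ : (ζ : O) = ζ1 := rfl
  have hζ' : IsPrimitiveRoot ζ q := by
    rw [← IsPrimitiveRoot.coe_units_iff]; exact hζ1
  obtain ⟨f, hf1, hf2⟩ := exists_twist g ζ (by rw [← hζ'.eq_orderOf]; exact hg) q hζ'.pow_eq_one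
  have hf3 : ∀ x, IsLocalRing.residue O (f x) = 1 := by
    intro x
    have h1 : (IsLocalRing.residue O (f x)) ^ q = 1 := by
      rw [← map_pow, ← Units.val_pow_eq_pow_val, hf2]; simp
    have h2 : (IsLocalRing.residue O (f x) - 1) ^ q = 0 := by
      rw [sub_pow_char, h1]; simp
    exact sub_eq_zero.1 (pow_eq_zero_iff hq.ne_zero |>.1 h2)
  have hf4 : ∀ x, IsLocalRing.residue O ((f x)⁻¹ : Oˣ) = 1 := by
    intro x
    have : IsLocalRing.residue O (f x * (f x)⁻¹ : Oˣ) = 1 := by simp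
    rw [Units.val_mul, map_mul, hf3, one_mul] at this
    exact this
  let E : Matrix G G O := Matrix.of fun x y => (mu⁻¹ : Oˣ) * χ (x⁻¹ * y)
  let D : Matrix G G O := Matrix.diagonal fun x => (f x : O)
  let D' : Matrix G G O := Matrix.diagonal fun x => ((f x)⁻¹ : Oˣ)
  have hDD' : D * D' = 1 := by
    simp only [D, D', Matrix.diagonal_mul_diagonal, Units.mul_inv, Matrix.diagonal_one]
  have hD'D : D' * D = 1 := by
    simp only [D, D', Matrix.diagonal_mul_diagonal, Units.inv_mul, Matrix.diagonal_one]
  let L : Matrix G G O := Matrix.of fun x y => if x = g * y then 1 else 0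
  have hLM : ∀ (M : Matrix G G O) x y, (L * M) x y = M (g⁻¹ * x) y := by
    intro M x y
    have : ∀ j, x = g * j ↔ g⁻¹ * x = j := fun j => by rw [inv_mul_eq_iff_eq_mul]
    simp [L, Matrix.mul_apply, this]
  have hML : ∀ (M : Matrix G G O) x y, (M * L) x y = M x (g * y) := by
    intro M x y
    simp [L, Matrix.mul_apply]
  have hEE : E * E = E := by
    ext1 x y
    rw [Matrix.mul_apply]
    simp only [E, Matrix.of_apply]
    have h1 := hχ (x⁻¹ * y)
    have h2 : ∑ j, χ (x⁻¹ * j) * χ (j⁻¹ * y) = m * χ (x⁻¹ * y) := by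
      rw [← h1]
      refine Fintype.sum_equiv ((Equiv.inv G).trans (Equiv.mulRight x)) _ _ fun j => ?_
      simp [mul_assoc]
    calc ∑ j, (mu⁻¹ : Oˣ) * χ (x⁻¹ * j) * ((mu⁻¹ : Oˣ) * χ (j⁻¹ * y))
        = (mu⁻¹ : Oˣ) * (mu⁻¹ : Oˣ) * ∑ j, χ (x⁻¹ * j) * χ (j⁻¹ * y) := by
          rw [Finset.mul_sum]; exact Finset.sum_congr rfl fun _ _ => by ring
      _ = (mu⁻¹ : Oˣ) * ((mu⁻¹ : Oˣ) * mu) * χ (x⁻¹ * y) := by rw [h2, ← hmu]; ring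
      _ = _ := by rw [Units.inv_mul, mul_one]
  have hLE : L * E = E * L := by
    ext1 x y
    rw [hLM, hML]
    simp [E, mul_assoc]
  have hLD : L * D = (ζ⁻¹ : Oˣ) • (D * L) := by
    ext1 x y
    rw [hLM, Matrix.smul_apply, hML]
    by_cases hxy : x = g * y
    · subst hxy
      simp only [D, inv_mul_cancel_left, Matrix.diagonal_apply_eq, hf1]
      rw [Units.smul_def, smul_eq_mul, ← Units.val_mul, inv_mul_cancel_left]
    · have h' : g⁻¹ * x ≠ y := fun h => hxy (by rw [← h]; simp)
      simp [D, Matrix.diagonal_apply_ne _ hxy, Matrix.diagonal_apply_ne _ h']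
  have hD'L : D' * L = (ζ⁻¹ : Oˣ) • (L * D') := by
    calc D' * L = D' * (L * D) * D' := by rw [mul_assoc, mul_assoc, hDD', mul_one]
      _ = (ζ⁻¹ : Oˣ) • (D' * D * L * D') := by rw [hLD]; simp [mul_assoc]
      _ = _ := by rw [hD'D, one_mul]
  have hLD' : L * D' = ζ • (D' * L) := by rw [hD'L, smul_smul]; simp
  set F := D * E * D' with hF
  have hFF : F * F = F := by
    calc F * F = D * E * (D' * D) * E * D' := by simp only [hF, mul_assoc]
      _ = D * (E * E) * D' := by rw [hD'D, mul_one]; simp only [mul_assoc]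
      _ = F := by rw [hEE]
  have hLF : L * F = F * L := by
    calc L * F = (L * D) * E * D' := by simp only [hF, mul_assoc]
      _ = (ζ⁻¹ : Oˣ) • (D * (L * E) * D') := by rw [hLD]; simp only [smul_mul_assoc, mul_assoc]
      _ = (ζ⁻¹ : Oˣ) • (D * E * (L * D')) := by rw [hLE]; simp only [mul_assoc]
      _ = F * L := by
        rw [hLD', mul_smul_comm, smul_smul, inv_mul_cancel, one_smul, hF]
        simp only [mul_assoc]
  have hEF : E.map (IsLocalRing.residue O) = F.map (IsLocalRing.residue O) := by
    ext1 x y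
    simp only [hF, D, D', Matrix.map_apply, Matrix.mul_diagonal, Matrix.diagonal_mul, map_mul,
      hf3, hf4, one_mul, mul_one]
  have htr := trace_eq E F L hEE hFF hEF hLE hLF
  have htr2 : (L * F).trace = (ζ⁻¹ : Oˣ) • (L * E).trace := by
    calc (L * F).trace = ((L * D) * E * D').trace := by simp only [hF, mul_assoc]
      _ = (ζ⁻¹ : Oˣ) • (D * (L * E) * D').trace := by
        rw [hLD, ← Matrix.trace_smul]; simp only [smul_mul_assoc, mul_assoc]
      _ = (ζ⁻¹ : Oˣ) • (L * E).trace := by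
        rw [Matrix.trace_mul_comm, ← mul_assoc, hD'D, one_mul]
  have htr3 : (L * E).trace = Fintype.card G * ((mu⁻¹ : Oˣ) * χ g) := by
    rw [Matrix.trace]
    have : ∀ x, (L * E).diag x = (mu⁻¹ : Oˣ) * χ g := by
      intro x
      rw [Matrix.diag_apply, hLM]
      simp only [E, Matrix.of_apply, mul_inv_rev, inv_inv]
      rw [mul_assoc, hχconj, mul_assoc, mul_inv_cancel, mul_one]
    rw [Finset.sum_congr rfl fun x _ => this x]
    simp
  have hz : (L * E).trace = 0 := by
    have h1 := htr.trans htr2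
    have h2 : (ζ : O) * (L * E).trace = (L * E).trace := by
      conv_lhs => rw [h1]
      rw [Units.smul_def, smul_eq_mul, ← mul_assoc, Units.mul_inv, one_mul]
    have h3 : ((ζ : O) - 1) * (L * E).trace = 0 := by rw [sub_mul, h2]; ring
    rcases mul_eq_zero.1 h3 with h | h
    · exact absurd (sub_eq_zero.1 h) (by rw [hζ]; exact hζ1.ne_one hq.one_lt)
    · exact h
  rw [htr3] at hz
  have hcard : (Fintype.card G : O) ≠ 0 := by
    intro h
    have := congrArg Subtype.val h
    simp at this
  have h4 : χ g = 0 := by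
    rcases mul_eq_zero.1 hz with h | h
    · exact absurd h hcard
    · exact (Units.mul_right_eq_zero _).1 h
  exact congrArg Subtype.val h4

end DZ

theorem stmt_6 (G : Type) [Group G] [Fintype G] (q : ℕ) (hq : q.Prime)
    (V : FDRep ℂ G) (hV : CategoryTheory.Simple V)
    (hdef : ¬ q ∣ Fintype.card G / Module.finrank ℂ V) :
    ∀ g : G, q ∣ orderOf g → V.character g = 0 := by 
  intro g hg
  exact DZ.main G q hq V hV hdef g hg
end

section
/- Let G be a finite group, N a normal subgroup of G, and q a prime. If N has an irreducible character of q-defect zero, then every element of N whose order is divisible by q is a vanishing element of G. -/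
open CategoryTheory

theorem aux_schur {G : Type} [Group G] (V : FDRep ℂ G) [Simple V] (T : V →ₗ[ℂ] V)
    (hT : ∀ g, V.ρ g ∘ₗ T = T ∘ₗ V.ρ g) : ∃ c : ℂ, T = c • LinearMap.id := by
  have h1 : Module.finrank ℂ (Representation.linHom V.ρ V.ρ).invariants = 1 := by
    rw [LinearEquiv.finrank_eq (Representation.linHom.invariantsEquivFDRepHom V V)]
    exact finrank_endomorphism_simple_eq_one ℂ V
  have key : ∀ S : V →ₗ[ℂ] V, (∀ g, V.ρ g ∘ₗ S = S ∘ₗ V.ρ g) →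
      S ∈ (Representation.linHom V.ρ V.ρ).invariants := by
    intro S hS
    rw [Representation.mem_invariants]
    intro g
    rw [Representation.linHom_apply, ← hS, ← LinearMap.comp_assoc]
    have := map_mul V.ρ g g⁻¹
    rw [mul_inv_cancel, map_one] at this
    change (V.ρ g * V.ρ g⁻¹) * S = S
    rw [← this, one_mul]
  have hid : (LinearMap.id : V →ₗ[ℂ] V) ≠ 0 := by
    intro h0
    have : Subsingleton (V →ₗ[ℂ] V) := by
      refine ⟨fun a b => ?_⟩
      rw [← LinearMap.comp_id a, ← LinearMap.comp_id b, h0]; simp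
    have : Subsingleton (Representation.linHom V.ρ V.ρ).invariants := inferInstance
    have := Module.finrank_zero_of_subsingleton (R := ℂ) (M := (Representation.linHom V.ρ V.ρ).invariants)
    omega
  let i : (Representation.linHom V.ρ V.ρ).invariants := ⟨LinearMap.id, key _ (by intro g; rfl)⟩
  have hi : i ≠ 0 := fun h => hid (congrArg Subtype.val h)
  obtain ⟨c, hc⟩ := (finrank_eq_one_iff_of_nonzero' i hi).1 h1 ⟨T, key T hT⟩
  exact ⟨c, (congrArg Subtype.val hc).symm⟩

theorem aux_L2 {G : Type} [Group G] [Fintype G] (V : FDRep ℂ G) [Simple V] (h x : G) :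
    (Module.finrank ℂ V : ℂ) * ∑ g : G, V.character (h * (g * x * g⁻¹)) =
      Fintype.card G * V.character x * V.character h := by
  obtain ⟨c, hc⟩ := aux_schur V (∑ g : G, V.ρ (g * x * g⁻¹)) (by
    intro k
    change V.ρ k * _ = _ * V.ρ k
    rw [Finset.mul_sum, Finset.sum_mul]
    refine Fintype.sum_equiv (Equiv.mulLeft k) _ _ fun g => ?_
    rw [← map_mul, ← map_mul]
    congr 1
    simp only [Equiv.coe_mulLeft]; group)
  have h1 := congrArg (LinearMap.trace ℂ V) hc
  have h2 := congrArg (fun T => LinearMap.trace ℂ V (V.ρ h * T)) hc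
  have e1 : (Fintype.card G : ℂ) * V.character x = c * Module.finrank ℂ V := by
    rw [map_sum, map_smul, LinearMap.trace_id] at h1
    rw [smul_eq_mul] at h1
    rw [← h1]
    change _ = ∑ g : G, V.character (g * x * g⁻¹)
    simp
  have e2 : ∑ g : G, V.character (h * (g * x * g⁻¹)) = c * V.character h := by
    simp only [Finset.mul_sum, map_sum, ← map_mul] at h2
    refine Eq.trans h2 ?_
    rw [mul_smul_comm, map_smul, smul_eq_mul]; rfl
  rw [e1, e2]; ring

theorem aux_L3 {G : Type} [Group G] [Fintype G] (V : FDRep ℂ G) [Simple V] (h : G) :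
    (Module.finrank ℂ V : ℂ) * ∑ g : G, V.character g⁻¹ * V.character (h * g) =
      Fintype.card G * V.character h := by
  obtain ⟨c, hc⟩ := aux_schur V (∑ g : G, V.character g⁻¹ • V.ρ g) (by
    intro k
    change V.ρ k * _ = _ * V.ρ k
    rw [Finset.mul_sum, Finset.sum_mul]
    refine Fintype.sum_equiv (MulAut.conj k).toEquiv _ _ fun g => ?_
    rw [mul_smul_comm, smul_mul_assoc, ← map_mul, ← map_mul]
    have : ((MulAut.conj k).toEquiv g) = k * g * k⁻¹ := rfl
    rw [this]
    have h3 : (k * g * k⁻¹)⁻¹ = k * g⁻¹ * k⁻¹ := by group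
    rw [h3, FDRep.char_conj]
    congr 2
    group)
  have h1 := congrArg (LinearMap.trace ℂ V) hc
  have h2 := congrArg (fun T => LinearMap.trace ℂ V (V.ρ h * T)) hc
  have e1 : (Fintype.card G : ℂ) = c * Module.finrank ℂ V := by
    rw [map_sum, map_smul, LinearMap.trace_id] at h1
    rw [smul_eq_mul] at h1
    rw [← h1]
    have := (FDRep.simple_iff_char_is_norm_one V).1 inferInstance
    rw [Nat.card_eq_fintype_card] at this
    rw [← this]
    refine Finset.sum_congr rfl fun g _ => ?_
    rw [map_smul, smul_eq_mul, mul_comm]; rfl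
  have e2 : ∑ g : G, V.character g⁻¹ * V.character (h * g) = c * V.character h := by
    simp only [Finset.mul_sum, map_sum, mul_smul_comm, map_smul, ← map_mul] at h2
    refine Eq.trans h2 ?_
    rw [smul_eq_mul]; rfl
  rw [e1, e2]; ring

theorem aux_deg {G : Type} [Group G] [Fintype G] (V : FDRep ℂ G) [Simple V] :
    (Module.finrank ℂ V : ℂ) ≠ 0 := by
  intro h
  have h0 : ∀ g, V.character g = 0 := by
    intro g
    have := aux_L3 V g
    rw [h, zero_mul] at this
    simpa using this.symm
  have := (FDRep.simple_iff_char_is_norm_one V).1 inferInstance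
  simp [h0] at this
  exact Fintype.card_ne_zero (by exact_mod_cast this.symm)

theorem aux_trace {R ι : Type*} [CommRing R] [IsDomain R] [IsLocalRing R] [Fintype ι]
    [DecidableEq ι] (E X D : Matrix ι ι R) (ζ : R) (hE : E * E = E) (hX : X * E = E * X)
    (hD : D * X = ζ • (X * D)) (hζ : ζ ≠ 1)
    (h1 : D.map (IsLocalRing.residue R) = 1) : (X * E).trace = 0 := by
  set w := E * D * E + (1 - E) with hw
  have hdet : IsUnit w.det := by
    apply isUnit_of_map_unit (IsLocalRing.residue R)
    have : (IsLocalRing.residue R).mapMatrix w = 1 := by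
      rw [hw, map_add, map_mul, map_mul, map_sub, map_one]
      have h2 : (IsLocalRing.residue R).mapMatrix D = 1 := h1
      rw [h2, mul_one, ← map_mul, hE]; abel
    rw [RingHom.map_det, this, Matrix.det_one]
    exact isUnit_one
  have hc : w * (X * E) = ζ • ((X * E) * w) := by
    have a1 : w * (X * E) = E * D * X * E := by
      rw [hw, add_mul, sub_mul, one_mul]
      have : E * (X * E) = X * E := by rw [← mul_assoc, ← hX, mul_assoc, hE]
      rw [this, mul_assoc (E * D), this]; simp [mul_assoc]
    have a2 : (X * E) * w = E * (X * D) * E := by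
      have z1 : X * E * E = X * E := by rw [mul_assoc, hE]
      rw [hw, mul_add, mul_sub, mul_one, z1, sub_self, add_zero, ← mul_assoc,
        ← mul_assoc, z1, hX]; simp [mul_assoc]
    rw [a1, a2, mul_assoc E, hD]
    simp
  have ht : (X * E).trace = ζ * (X * E).trace := by
    have b1 : X * E = ζ • (w⁻¹ * ((X * E) * w)) := by
      rw [← mul_smul_comm, ← hc, ← mul_assoc, Matrix.nonsing_inv_mul _ hdet, one_mul]
    conv_lhs => rw [b1]
    rw [Matrix.trace_smul, Matrix.trace_mul_comm, mul_assoc, Matrix.mul_nonsing_inv _ hdet, mul_one,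
      smul_eq_mul]
  have : (ζ - 1) * (X * E).trace = 0 := by rw [sub_mul, one_mul, ← ht, sub_self]
  exact (mul_eq_zero.1 this).resolve_left (sub_ne_zero.2 hζ)

theorem aux_phi {G : Type} [Group G] (x : G) (q : ℕ) (hx : q ∣ orderOf x) :
    ∃ i : G → ℤ, ∀ h, (q : ℤ) ∣ i (x * h) - (i h + 1) := by
  let s : Setoid G := QuotientGroup.rightRel (Subgroup.zpowers x)
  have : ∀ h : G, ∃ i : ℤ, x ^ i * (Quotient.mk s h).out = h := by
    intro h
    have h1 : s (Quotient.mk s h).out h := Quotient.exact (Quotient.out_eq _)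
    have h2 := QuotientGroup.rightRel_apply.1 h1
    obtain ⟨i, hi⟩ := Subgroup.mem_zpowers_iff.1 h2
    exact ⟨i, by rw [hi]; group⟩
  choose i hi using this
  refine ⟨i, fun h => ?_⟩
  have h1 : Quotient.mk s (x * h) = Quotient.mk s h := by
    apply Quotient.sound
    change s _ _
    rw [QuotientGroup.rightRel_apply]
    simp
  have h2 := hi (x * h)
  rw [h1] at h2
  have h3 : x * h = x ^ (i h + 1) * (Quotient.mk s h).out := by
    conv_lhs => rw [← hi h]
    rw [← mul_assoc, ← zpow_one_add, add_comm]
  have h4 := mul_right_cancel (h2.trans h3)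
  have h5 : x ^ (i (x * h) - (i h + 1)) = 1 := by rw [zpow_sub, h4]; simp
  have h6 := orderOf_dvd_iff_zpow_eq_one.2 h5
  exact (Int.natCast_dvd_natCast.2 hx).trans h6

theorem aux_val (q : ℕ) (hq : q.Prime) : ∃ B : ValuationSubring ℂ, (q : ℂ) ∈ B.nonunits := by
  let A : Subring ℂ := (Int.castRingHom ℂ).range
  let Q : A := ⟨(q : ℂ), ⟨q, by simp⟩⟩
  obtain ⟨B, -, hB⟩ := Ideal.image_subset_nonunits_valuationSubring (Ideal.span {Q}) (by
    rw [Ne, Ideal.span_singleton_eq_top]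
    intro h
    obtain ⟨⟨_, ⟨n, rfl⟩⟩, hn⟩ := h.exists_right_inv
    have := congrArg Subtype.val hn
    have h2 : (q : ℂ) * (n : ℂ) = 1 := this
    have h3 : (q : ℤ) * n = 1 := by exact_mod_cast h2
    have := Int.eq_one_or_neg_one_of_mul_eq_one h3
    have := hq.two_le
    omega)
  exact ⟨B, hB ⟨Q, Ideal.subset_span rfl, rfl⟩⟩

theorem aux_int_mem (B : ValuationSubring ℂ) {z : ℂ} (hz : IsIntegral ℤ z) : z ∈ B := by
  have : IsIntegral B z := hz.tower_top
  obtain ⟨y, hy⟩ := IsIntegrallyClosed.isIntegral_iff.1 this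
  rw [← hy]; exact y.2

theorem aux_char_int {G : Type} [Group G] [Fintype G] (V : FDRep ℂ G) (g : G) :
    IsIntegral ℤ (V.character g) := by
  have h := Module.End.trace_eq_sum_roots_charpoly_of_splits (f := V.ρ g) (IsAlgClosed.splits _)
  unfold FDRep.character
  rw [h]
  have key : ∀ r ∈ (LinearMap.charpoly (V.ρ g)).roots, IsIntegral ℤ r := by
    intro r hr
    have h1 := Polynomial.isRoot_of_mem_roots hr
    have h2 : Module.End.HasEigenvalue (V.ρ g) r := Module.End.hasEigenvalue_iff_isRoot_charpoly _ _ |>.2 h1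
    obtain ⟨v, hv⟩ := h2.exists_hasEigenvector
    have h3 := hv.pow_apply (Fintype.card G)
    rw [← map_pow, pow_card_eq_one, map_one] at h3
    have h4 : (r ^ Fintype.card G - 1) • v = 0 := by
      rw [sub_smul, ← h3, one_smul]; simp
    have h5 := (smul_eq_zero.1 h4).resolve_right hv.2
    refine IsIntegral.of_pow (n := Fintype.card G) Fintype.card_pos ?_
    rw [sub_eq_zero.1 h5]; exact isIntegral_one
  exact IsIntegral.multiset_sum key

theorem aux_dvd {G : Type} [Group G] [Fintype G] (V : FDRep ℂ G) [Simple V] :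
    Module.finrank ℂ V ∣ Fintype.card G := by
  classical
  let O := integralClosure ℤ ℂ
  let M' : Matrix G G O := fun h k => ⟨V.character (k⁻¹ * h), aux_char_int V _⟩
  let M : Matrix G G ℂ := fun h k => V.character (k⁻¹ * h)
  set c : ℂ := Fintype.card G / Module.finrank ℂ V with hc
  have hd := aux_deg V
  have hM : M.mulVec V.character = c • V.character := by
    ext h
    have := aux_L3 V h
    simp only [Matrix.mulVec, dotProduct, M, Pi.smul_apply, smul_eq_mul]
    rw [hc, div_mul_eq_mul_div, eq_div_iff hd, ← this, mul_comm]
    congr 1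
    refine Fintype.sum_equiv (Equiv.mulLeft h⁻¹) _ _ fun k => ?_
    simp
  have hint : IsIntegral ℤ c := by
    have h1 : M.charpoly.eval c = 0 := by
      rw [Matrix.eval_charpoly]
      apply Matrix.exists_mulVec_eq_zero_iff.1
      refine ⟨V.character, ?_, ?_⟩
      · intro h0
        apply hd
        rw [← FDRep.char_one, h0]; rfl
      · rw [Matrix.sub_mulVec, hM]
        ext k
        simp
    have h2 : M = M'.map (algebraMap O ℂ) := rfl
    have h3 : IsIntegral O c := by
      refine ⟨M'.charpoly, M'.charpoly_monic, ?_⟩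
      rw [h2, Matrix.charpoly_map, Polynomial.eval_map] at h1
      exact h1
    exact isIntegral_trans c h3
  have hq : IsIntegral ℤ ((Fintype.card G / Module.finrank ℂ V : ℚ)) := by
    have : c = algebraMap ℚ ℂ (Fintype.card G / Module.finrank ℂ V : ℚ) := by simp [hc]
    rw [this] at hint
    exact (isIntegral_algebraMap_iff (algebraMap ℚ ℂ).injective).1 hint
  obtain ⟨n, hn⟩ := IsIntegrallyClosed.isIntegral_iff.1 hq
  have hd' : (Module.finrank ℂ V : ℚ) ≠ 0 := by exact_mod_cast hd
  rw [eq_div_iff hd'] at hn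
  have : n * (Module.finrank ℂ V : ℤ) = Fintype.card G := by
    simp at hn
    exact_mod_cast hn
  exact Int.natCast_dvd_natCast.1 ⟨n, by rw [← this]; ring⟩

theorem aux_vanish {G : Type} [Group G] [Fintype G] (V : FDRep ℂ G) [Simple V] (q : ℕ)
    (hq : q.Prime) (hdef : ¬ q ∣ Fintype.card G / Module.finrank ℂ V) (x : G)
    (hx : q ∣ orderOf x) : V.character x⁻¹ = 0 := by
  classical
  obtain ⟨c, hc⟩ := aux_dvd V
  have hd := aux_deg V
  have hdn : Module.finrank ℂ V ≠ 0 := by exact_mod_cast hd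
  rw [hc, Nat.mul_div_cancel_left _ (Nat.pos_of_ne_zero hdn)] at hdef
  have hcc : (Fintype.card G : ℂ) = Module.finrank ℂ V * c := by exact_mod_cast hc
  obtain ⟨B, hB⟩ := aux_val q hq
  obtain ⟨hqB, hqm⟩ := ValuationSubring.mem_nonunits_iff_exists_mem_maximalIdeal.1 hB
  have hq0 : IsLocalRing.residue B (q : B) = 0 := (IsLocalRing.residue_eq_zero_iff _).2 hqm
  -- c is a unit
  have hcu : IsUnit (c : B) := by
    by_contra hcon
    have h1 : (c : B) ∈ IsLocalRing.maximalIdeal B := hcon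
    have h2 := (IsLocalRing.residue_eq_zero_iff _).2 h1
    have hcop : IsCoprime (q : ℤ) (c : ℤ) :=
      Nat.isCoprime_iff_coprime.2 ((Nat.Prime.coprime_iff_not_dvd hq).2 hdef)
    obtain ⟨a, b, hab⟩ := hcop
    have h3 := congrArg (fun z : ℤ => IsLocalRing.residue B (z : B)) hab
    simp only [Int.cast_add, Int.cast_mul, Int.cast_natCast, map_add, map_mul, hq0, h2,
      mul_zero, add_zero, Int.cast_one, map_one] at h3
    exact zero_ne_one h3
  obtain ⟨u, hu⟩ := hcu.exists_left_inv
  -- the root of unity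
  have hζp := Complex.isPrimitiveRoot_exp q hq.ne_zero
  set z := Complex.exp (2 * Real.pi * Complex.I / q) with hz
  have hzint : IsIntegral ℤ z := by
    refine IsIntegral.of_pow (n := q) hq.pos ?_
    rw [hζp.pow_eq_one]; exact isIntegral_one
  let ζ : B := ⟨z, aux_int_mem B hzint⟩
  have hζq : ζ ^ q = 1 := Subtype.ext hζp.pow_eq_one
  have hζ1 : ζ ≠ 1 := fun h => hζp.ne_one hq.one_lt (congrArg Subtype.val h)
  have hζres : IsLocalRing.residue B ζ = 1 := by
    have : Fact q.Prime := ⟨hq⟩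
    have : CharP (IsLocalRing.ResidueField B) q :=
      (CharP.charP_iff_prime_eq_zero hq).2 (by rw [← map_natCast (IsLocalRing.residue B)]; exact hq0)
    have h1 : (IsLocalRing.residue B ζ - 1) ^ q = 0 := by
      rw [sub_pow_char, ← map_pow, hζq]; simp
    exact sub_eq_zero.1 (pow_eq_zero_iff hq.ne_zero |>.1 h1)
  obtain ⟨i, hi⟩ := aux_phi x q hx
  let j : G → ℕ := fun h => (i h % q).toNat
  have hqpos : (0 : ℤ) < q := by exact_mod_cast hq.pos
  have hj : ∀ h, ζ ^ j (x * h) = ζ * ζ ^ j h := by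
    intro h
    rw [← pow_succ']
    apply pow_eq_pow_of_modEq _ hζq
    have e : ∀ h, ((j h : ℕ) : ℤ) = i h % q := fun h =>
      Int.toNat_of_nonneg (Int.emod_nonneg _ hqpos.ne')
    rw [← Int.natCast_modEq_iff]
    push_cast
    rw [e, e]
    have h1 : i (x * h) ≡ i h + 1 [ZMOD q] := (Int.modEq_iff_dvd.2 (by
      have := hi h
      rwa [← dvd_neg, neg_sub] at this))
    exact (Int.mod_modEq _ _).trans (h1.trans ((Int.mod_modEq _ _).symm.add_right 1))
  let θ : G → B := fun g => ⟨V.character g, aux_int_mem B (aux_char_int V g)⟩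
  let E : Matrix G G B := fun g h => u * θ (h⁻¹ * g)
  let X : Matrix G G B := fun g h => if g = x * h then 1 else 0
  let D : Matrix G G B := Matrix.diagonal fun h => ζ ^ j h
  have hXE : ∀ g h, (X * E) g h = u * θ (h⁻¹ * x⁻¹ * g) := by
    intro g h
    rw [Matrix.mul_apply, Finset.sum_eq_single (x⁻¹ * g)]
    · simp [X, E, mul_assoc]
    · intro b _ hb
      have : g ≠ x * b := fun h => hb (by rw [h]; simp)
      simp [X, this]
    · simp
  have hEX : ∀ g h, (E * X) g h = u * θ (h⁻¹ * x⁻¹ * g) := by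
    intro g h
    rw [Matrix.mul_apply, Finset.sum_eq_single (x * h)]
    · simp [X, E]
    · intro b _ hb
      simp [X, hb]
    · simp
  have hθ : ∀ g h, ∑ k, θ (k⁻¹ * g) * θ (h⁻¹ * k) = c * θ (h⁻¹ * g) := by
    intro g h
    apply Subtype.ext
    have h1 := aux_L3 V (h⁻¹ * g)
    rw [hcc, mul_assoc] at h1
    have h2 := mul_left_cancel₀ hd h1
    have h3 : ((∑ k, θ (k⁻¹ * g) * θ (h⁻¹ * k) : B) : ℂ) =
        ∑ k, V.character (k⁻¹ * g) * V.character (h⁻¹ * k) := by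
      rw [← ValuationSubring.subtype_apply, map_sum]; rfl
    rw [h3]
    refine Eq.trans ?_ (h2.trans ?_)
    · refine Fintype.sum_equiv (Equiv.mulLeft g⁻¹) _ _ fun k => ?_
      simp [mul_assoc]
    · simp [θ]
  have hEE : E * E = E := by
    ext1 g h
    rw [Matrix.mul_apply]
    have : ∀ k, E g k * E k h = u * u * (θ (k⁻¹ * g) * θ (h⁻¹ * k)) := by
      intro k; simp only [E]; ring
    simp only [this]
    rw [← Finset.mul_sum, hθ]
    calc u * u * (c * θ (h⁻¹ * g)) = (u * c) * (u * θ (h⁻¹ * g)) := by ring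
      _ = E g h := by rw [hu, one_mul]
  have ht := aux_trace E X D ζ hEE (by ext1 g h; rw [hXE, hEX]) (by
      ext1 g h
      rw [Matrix.smul_apply, Matrix.diagonal_mul, Matrix.mul_diagonal]
      by_cases hg : g = x * h
      · subst hg; simp [X, hj]
      · simp [X, hg]) hζ1 (by
      ext1 g h
      by_cases hg : g = h
      · subst hg; simp [D, hζres]
      · simp [D, hg])
  have ht2 : (X * E).trace = Fintype.card G * (u * θ x⁻¹) := by
    rw [Matrix.trace]
    have : ∀ g, Matrix.diag (X * E) g = u * θ x⁻¹ := by
      intro g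
      rw [Matrix.diag_apply, hXE]
      congr 1
      apply Subtype.ext
      have := FDRep.char_conj V x⁻¹ g⁻¹
      rw [inv_inv] at this
      exact this
    simp only [this]
    rw [Finset.sum_const, Finset.card_univ, nsmul_eq_mul]
  rw [ht2] at ht
  have hu0 : u ≠ 0 := by rintro rfl; simp at hu
  have hN : (Fintype.card G : B) ≠ 0 := by
    intro h
    have := congrArg (fun b : B => (b : ℂ)) h
    simp at this
  have := ((mul_eq_zero.1 ht).resolve_left hN)
  exact congrArg Subtype.val ((mul_eq_zero.1 this).resolve_left hu0)

theorem aux_fin {G : Type} [Group G] [Fintype G] (S : Type) [AddCommMonoid S]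
    [Module (MonoidAlgebra ℂ G) S] [hf : Module.Finite (MonoidAlgebra ℂ G) S] :
    Module.Finite ℂ (RestrictScalars ℂ (MonoidAlgebra ℂ G) S) := by
  let m1 := RestrictScalars.moduleOrig ℂ (MonoidAlgebra ℂ G) S
  have : Module.Finite (MonoidAlgebra ℂ G) (RestrictScalars ℂ (MonoidAlgebra ℂ G) S) := hf
  exact Module.Finite.trans (MonoidAlgebra ℂ G) _

theorem aux_simple0 {G : Type} [Group G] [Fintype G] (S : Type) [AddCommGroup S]
    [Module (MonoidAlgebra ℂ G) S] [hSs : IsSimpleModule (MonoidAlgebra ℂ G) S]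
    [hf : Module.Finite (MonoidAlgebra ℂ G) S]
    (e : MonoidAlgebra ℂ G) (hs : ∃ s : S, e • s ≠ 0) :
    ∃ (W : Type) (_ : AddCommGroup W) (_ : Module ℂ W) (ρ : Representation ℂ G W),
      ρ.IsIrreducible ∧ Module.Finite ℂ W ∧ ∃ w, ρ.asAlgebraHom e w ≠ 0 := by
  obtain ⟨s, hs⟩ := hs
  refine ⟨RestrictScalars ℂ (MonoidAlgebra ℂ G) S, inferInstanceAs (AddCommGroup S),
    RestrictScalars.module ℂ (MonoidAlgebra ℂ G) S,
    Representation.ofModule (k := ℂ) (G := G) S,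
    (Representation.isSimpleModule_iff_irreducible_ofModule (k := ℂ) (G := G) S).1 hSs, ?_, ?_⟩
  · exact aux_fin (G := G) S
  · refine ⟨(RestrictScalars.addEquiv ℂ (MonoidAlgebra ℂ G) S).symm s, fun h4 => hs ?_⟩
    have h3 := Representation.ofModule_asAlgebraHom_apply_apply (k := ℂ) (G := G) (M := S) e
      ((RestrictScalars.addEquiv _ _ _).symm s)
    have h5 := h4.symm.trans h3
    have h6 := congrArg (RestrictScalars.addEquiv ℂ (MonoidAlgebra ℂ G) S) h5
    rw [AddEquiv.apply_symm_apply, AddEquiv.apply_symm_apply] at h6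
    exact h6.symm

theorem aux_simple {G : Type} [Group G] [Fintype G] (S : Type) [AddCommGroup S]
    [Module (MonoidAlgebra ℂ G) S] [hSs : IsSimpleModule (MonoidAlgebra ℂ G) S]
    [Module.Finite (MonoidAlgebra ℂ G) S]
    (e : MonoidAlgebra ℂ G) (he : IsIdempotentElem e) (hs : ∃ s : S, e • s ≠ 0) :
    ∃ V : FDRep ℂ G, Simple V ∧
      LinearMap.trace ℂ V (Representation.asAlgebraHom V.ρ e) ≠ 0 := by
  classical
  obtain ⟨W, _, _, ρ, _, _, w, hw⟩ := aux_simple0 S e hs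
  letI : Invertible (Nat.card G : ℂ) := invertibleOfNonzero (by simp)
  refine ⟨FDRep.of ρ, ?_, ?_⟩
  · rw [FDRep.simple_iff_char_is_norm_one]
    have := Representation.char_orthonormal ρ ρ
    rw [if_pos ⟨Representation.Equiv.refl ρ⟩] at this
    have h2 := (inv_mul_eq_one₀ (by simp)).1 this
    exact h2.symm
  · intro h0
    have hid : IsIdempotentElem (ρ.asAlgebraHom e) := he.map _
    have h1 : LinearMap.trace ℂ _ (ρ.asAlgebraHom e) = 0 := h0
    exact hw (by rw [LinearMap.IsIdempotentElem.eq_zero_of_trace_eq_zero hid h1]; rfl)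

theorem aux_exists {G : Type} [Group G] [Fintype G] (N : Subgroup G) [Fintype N]
    (θ : FDRep ℂ N) [Simple θ] : ∃ V : FDRep ℂ G, Simple V ∧
      ∑ n : N, θ.character n⁻¹ * V.character (n : G) ≠ 0 := by
  classical
  have hd := aux_deg θ
  set a : ℂ := Fintype.card N / Module.finrank ℂ θ with ha
  have ha0 : a ≠ 0 := div_ne_zero (by simp) hd
  let E0 : MonoidAlgebra ℂ G := ∑ n : N, θ.character n⁻¹ • MonoidAlgebra.of ℂ G (n : G)
  have hE0 : E0 ≠ 0 := by
    intro h
    have h1 := congrArg (fun f : MonoidAlgebra ℂ G => f.coeff 1) h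
    have h2 : E0.coeff 1 = θ.character 1 := by
      simp only [E0, MonoidAlgebra.of_apply]
      simp [MonoidAlgebra.coeff_sum, Finsupp.single_apply]
    simp only [h2, FDRep.char_one] at h1
    exact hd h1
  have hEE : E0 * E0 = a • E0 := by
    simp only [E0]
    rw [Finset.sum_mul_sum]
    have : ∀ n m : N, (θ.character n⁻¹ • MonoidAlgebra.of ℂ G (n : G)) *
        (θ.character m⁻¹ • MonoidAlgebra.of ℂ G (m : G)) =
        (θ.character n⁻¹ * θ.character m⁻¹) • MonoidAlgebra.of ℂ G ((n * m : N) : G) := by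
      intro n m
      rw [smul_mul_smul_comm, ← map_mul]; rfl
    simp only [this]
    have h2 : ∀ n : N, ∑ m : N, (θ.character n⁻¹ * θ.character m⁻¹) • MonoidAlgebra.of ℂ G ((n * m : N) : G)
        = ∑ k : N, (θ.character n⁻¹ * θ.character (k⁻¹ * n)) • MonoidAlgebra.of ℂ G (k : G) := by
      intro n
      refine Fintype.sum_equiv (Equiv.mulLeft n) _ _ fun m => ?_
      simp
    simp only [h2]
    rw [Finset.sum_comm, Finset.smul_sum]
    refine Finset.sum_congr rfl fun k _ => ?_
    rw [← Finset.sum_smul, smul_smul]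
    congr 1
    have := aux_L3 θ k⁻¹
    rw [ha, div_mul_eq_mul_div, eq_div_iff hd, ← this, mul_comm]
  let e : MonoidAlgebra ℂ G := a⁻¹ • E0
  have he : IsIdempotentElem e := by
    change (a⁻¹ • E0) * (a⁻¹ • E0) = a⁻¹ • E0
    rw [smul_mul_smul_comm, hEE, smul_smul]
    congr 1; field_simp
  have he0 : e ≠ 0 := smul_ne_zero (inv_ne_zero ha0) hE0
  have : NeZero (Nat.card G : ℂ) := ⟨by simp⟩
  have hS : ∃ S : Submodule (MonoidAlgebra ℂ G) (MonoidAlgebra ℂ G),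
      IsSimpleModule (MonoidAlgebra ℂ G) S ∧ ∃ s : S, e • s ≠ 0 := by
    by_contra! hcon
    have h1 : e ∈ (⊤ : Submodule (MonoidAlgebra ℂ G) (MonoidAlgebra ℂ G)).annihilator := by
      rw [← IsSemisimpleModule.sSup_simples_eq_top, sSup_eq_iSup', Submodule.annihilator_iSup,
        Submodule.mem_iInf]
      intro S
      rw [Submodule.mem_annihilator]
      intro n hn
      exact congrArg Subtype.val (hcon S.1 S.2 ⟨n, hn⟩)
    have := Submodule.mem_annihilator.1 h1 1 trivial
    apply he0
    simpa using this
  obtain ⟨S, hSs, s, hs⟩ := hS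
  have hfin : Module.Finite (MonoidAlgebra ℂ G) S := inferInstance
  obtain ⟨V, hV, hV2⟩ := aux_simple S e he ⟨s, hs⟩
  refine ⟨V, hV, fun h0 => hV2 ?_⟩
  simp only [e, E0, map_smul, map_sum, Representation.asAlgebraHom_of]
  rw [smul_eq_mul]
  refine mul_eq_zero_of_right _ ?_
  exact h0

theorem stmt_7 (G : Type) [Group G] [Fintype G] (N : Subgroup G) [N.Normal]
    (q : ℕ) (hq : q.Prime)
    (hdef : ∃ θ : FDRep ℂ ↥N, CategoryTheory.Simple θ ∧
      ¬ q ∣ Nat.card N / Module.finrank ℂ θ) :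
    ∀ x ∈ N, q ∣ orderOf x → IsVanishing G x := by
  classical
  intro x hxN hx
  obtain ⟨θ, hθ, hdef⟩ := hdef
  have : Fintype N := Fintype.ofFinite N
  rw [Nat.card_eq_fintype_card] at hdef
  have hdθ := aux_deg θ
  have hvan : ∀ y : N, q ∣ orderOf y → θ.character y = 0 := by
    intro y hy
    have := aux_vanish θ q hq hdef y⁻¹ (by rwa [orderOf_inv])
    rwa [inv_inv] at this
  obtain ⟨V, hV, hne⟩ := aux_exists N θ
  refine ⟨V, hV, ?_⟩
  have hdV := aux_deg V
  have hconv : ∀ y : N, q ∣ orderOf y →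
      ∑ h : N, θ.character h⁻¹ * V.character ((h : G) * y) = 0 := by
    intro y hy
    have h1 : ∀ n : N, ∑ h : N, θ.character h⁻¹ * V.character ((h : G) * y) =
        ∑ k : N, V.character (k : G) * θ.character (k⁻¹ * (n * y * n⁻¹)) := by
      intro n
      refine Fintype.sum_equiv ((Equiv.mulRight y).trans (MulAut.conj n).toEquiv) _ _ fun h => ?_
      have e0 : ((Equiv.mulRight y).trans (MulAut.conj n).toEquiv) h = n * (h * y) * n⁻¹ := rfl
      rw [e0]
      have e1 : ((n * (h * y) * n⁻¹ : N) : G) = n * (h * y) * (n : G)⁻¹ := rfl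
      have e2 : (n * (h * y) * n⁻¹)⁻¹ * (n * y * n⁻¹) = (n * y⁻¹) * h⁻¹ * (n * y⁻¹)⁻¹ := by
        group
      rw [e1, e2, FDRep.char_conj, FDRep.char_conj, mul_comm]
    have h2 : (Fintype.card N : ℂ) * ∑ h : N, θ.character h⁻¹ * V.character ((h : G) * y) = 0 := by
      calc _ = ∑ n : N, ∑ h : N, θ.character h⁻¹ * V.character ((h : G) * y) := by simp
        _ = ∑ n : N, ∑ k : N, V.character (k : G) * θ.character (k⁻¹ * (n * y * n⁻¹)) :=
            Finset.sum_congr rfl fun n _ => h1 n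
        _ = ∑ k : N, V.character (k : G) * ∑ n : N, θ.character (k⁻¹ * (n * y * n⁻¹)) := by
            rw [Finset.sum_comm]; simp only [Finset.mul_sum]
        _ = 0 := by
            refine Finset.sum_eq_zero fun k _ => mul_eq_zero_of_right _ ?_
            have := aux_L2 θ k⁻¹ y
            rw [hvan y hy, mul_zero, zero_mul] at this
            exact (mul_eq_zero.1 this).resolve_left hdθ
    exact (mul_eq_zero.1 h2).resolve_left (by simp)
  have hfin : (Fintype.card G : ℂ) * V.character x *
      ∑ n : N, θ.character n⁻¹ * V.character (n : G) = 0 := by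
    calc _ = ∑ n : N, θ.character n⁻¹ * (Fintype.card G * V.character x * V.character (n : G)) := by
            rw [Finset.mul_sum]; refine Finset.sum_congr rfl fun n _ => by ring
      _ = ∑ n : N, θ.character n⁻¹ * (Module.finrank ℂ V *
            ∑ g : G, V.character (n * (g * x * g⁻¹))) := by
            refine Finset.sum_congr rfl fun n _ => by rw [aux_L2 V]
      _ = Module.finrank ℂ V * ∑ g : G, ∑ n : N, θ.character n⁻¹ *
            V.character (n * (g * x * g⁻¹)) := by
            rw [Finset.sum_comm, Finset.mul_sum]
            refine Finset.sum_congr rfl fun n _ => ?_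
            rw [← Finset.mul_sum]; ring
      _ = 0 := by
            refine mul_eq_zero_of_right _ (Finset.sum_eq_zero fun g _ => ?_)
            have hg : g * x * g⁻¹ ∈ N := Subgroup.Normal.conj_mem inferInstance x hxN g
            refine hconv ⟨g * x * g⁻¹, hg⟩ ?_
            rw [Subgroup.orderOf_mk]
            have : orderOf (g * x * g⁻¹) = orderOf x := by
              have := MulEquiv.orderOf_eq (MulAut.conj g) x
              simpa using this
            rwa [this]
  have := (mul_eq_zero.1 hfin).resolve_right hne
  exact (mul_eq_zero.1 this).resolve_left (by simp)
end

section
/- Let G be a finite group, M = S₁ × ... × S_k a minimal normal subgroup of G where each S_i is isomorphic to a fixed non-abelian simple group S. If θ is an irreducible character of S that extends to an irreducible character of Aut(S), then the irreducible character θ × ... × θ of M extends to an irreducible character of G. -/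
open CategoryTheory in
theorem aux_simple_s13 {G : Type} [Group G] [Fintype G] (M : Subgroup G) (V : FDRep ℂ G)
    (h : Simple ((Action.res (FGModuleCat ℂ) M.subtype).obj V)) : Simple V := by
  classical
  have h1 := (FDRep.simple_iff_end_is_rank_one (k := ℂ) (G := M)
    ((Action.res (FGModuleCat ℂ) M.subtype).obj V)).1 h
  rw [FDRep.simple_iff_end_is_rank_one]
  let F : (V ⟶ V) →ₗ[ℂ] ((Action.res (FGModuleCat ℂ) M.subtype).obj V ⟶
      (Action.res (FGModuleCat ℂ) M.subtype).obj V) :=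
    { toFun := fun f => (Action.res (FGModuleCat ℂ) M.subtype).map f
      map_add' := fun _ _ => rfl
      map_smul' := fun _ _ => rfl }
  have hF : Function.Injective F := by
    intro f g hfg
    have : (F f).hom = (F g).hom := by rw [hfg]
    exact Action.Hom.ext this
  have hle := LinearMap.finrank_le_finrank_of_injective hF
  have hne : 0 < Module.finrank ℂ (V ⟶ V) := by
    rw [Module.finrank_pos_iff_exists_ne_zero]
    refine ⟨𝟙 V, fun h0 => ?_⟩
    have : F (𝟙 V) = 0 := by rw [h0, map_zero]
    exact id_nonzero ((Action.res (FGModuleCat ℂ) M.subtype).obj V) this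
  omega

/-- `φ` permutes coordinates by `σ` and twists by `a`. -/
def IsWr {S : Type} [Group S] {k : ℕ} (φ : MulAut (Fin k → S))
    (p : Equiv.Perm (Fin k) × (Fin k → MulAut S)) : Prop :=
  ∀ x j, φ x j = p.2 j (x (p.1 j))

theorem aux_exists_s13 {S : Type} [Group S] [Finite S] [IsSimpleGroup S]
    (hnab : ∃ a b : S, a * b ≠ b * a) {k : ℕ} (φ : MulAut (Fin k → S)) :
    ∃ p, IsWr φ p := by
  classical
  have key : ∀ j, ∃ i, ∃ a : MulAut S, ∀ x, φ x j = a (x i) := by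
    intro j
    let P : (Fin k → S) →* S := (Pi.evalMonoidHom (fun _ : Fin k => S) j).comp φ.toMonoidHom
    have hP : Function.Surjective P := by
      intro s
      obtain ⟨x, hx⟩ := φ.surjective (fun _ => s)
      exact ⟨x, congrFun hx j⟩
    let h : Fin k → (S →* S) := fun i => P.comp (MonoidHom.mulSingle (fun _ : Fin k => S) i)
    have hn : ∀ i, (h i).range.Normal := by
      intro i
      constructor
      rintro _ ⟨s, rfl⟩ g
      obtain ⟨y, rfl⟩ := hP g
      refine ⟨y i * s * (y i)⁻¹, ?_⟩
      show P (Pi.mulSingle i (y i * s * (y i)⁻¹)) = P y * P (Pi.mulSingle i s) * (P y)⁻¹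
      rw [← map_inv, ← map_mul, ← map_mul]
      congr 1
      ext l
      by_cases hl : l = i
      · subst hl; simp
      · simp [Pi.mulSingle_eq_of_ne hl]
    have hd : ∀ i, (h i).range = ⊥ ∨ (h i).range = ⊤ := fun i =>
      (hn i).eq_bot_or_eq_top
    have hex : ∃ i, (h i).range = ⊤ := by
      by_contra hcon
      push Not at hcon
      obtain ⟨s, hs⟩ := exists_ne (1 : S)
      obtain ⟨x, rfl⟩ := hP s
      apply hs
      have : x ∈ P.ker := by
        apply Subgroup.pi_mem_of_mulSingle_mem
        intro i
        have := (hd i).resolve_right (hcon i)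
        have h2 : h i (x i) ∈ (h i).range := ⟨_, rfl⟩
        rw [this, Subgroup.mem_bot] at h2
        exact h2
      exact this
    obtain ⟨i, hi⟩ := hex
    have hsurj : Function.Surjective (h i) := MonoidHom.range_eq_top.1 hi
    have hbij : Function.Bijective (h i) := hsurj.bijective_of_finite
    have htriv : ∀ l, l ≠ i → ∀ s, h l s = 1 := by
      intro l hl s
      rcases hd l with h0 | h1
      · have h2 : h l s ∈ (h l).range := ⟨_, rfl⟩
        rw [h0, Subgroup.mem_bot] at h2
        exact h2
      · exfalso
        obtain ⟨a, b, hab⟩ := hnab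
        obtain ⟨a', rfl⟩ := hsurj a
        obtain ⟨b', rfl⟩ := MonoidHom.range_eq_top.1 h1 b
        apply hab
        exact ((Pi.mulSingle_commute (f := fun _ : Fin k => S) hl.symm a' b').map P)
    refine ⟨i, MulEquiv.ofBijective (h i) hbij, fun x => ?_⟩
    show P x = P (Pi.mulSingle i (x i))
    have : x * (Pi.mulSingle i (x i))⁻¹ ∈ P.ker := by
      apply Subgroup.pi_mem_of_mulSingle_mem
      intro l
      by_cases hl : l = i
      · subst hl; simp
      · exact htriv l hl _
    rw [MonoidHom.mem_ker, map_mul, map_inv, mul_inv_eq_one] at this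
    exact this
  choose σ a ha using key
  have hσ : Function.Surjective σ := by
    intro i
    by_contra hcon
    push Not at hcon
    obtain ⟨s, hs⟩ := exists_ne (1 : S)
    have : φ (Pi.mulSingle i s) = 1 := by
      ext j
      rw [ha, Pi.mulSingle_eq_of_ne (hcon j)]; simp
    rw [map_eq_one_iff φ φ.injective, Pi.mulSingle_eq_one_iff] at this
    exact hs this
  exact ⟨(Equiv.ofBijective σ hσ.bijective_of_finite, a), fun x j => ha j x⟩

theorem aux_unique {S : Type} [Group S] [Nontrivial S] {k : ℕ} (φ : MulAut (Fin k → S))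
    (p q) (hp : IsWr φ p) (hq : IsWr φ q) : p = q := by
  classical
  have h1 : ∀ j, p.1 j = q.1 j := by
    intro j
    by_contra hne
    obtain ⟨s, hs⟩ := exists_ne (1 : S)
    have e1 := hp (Pi.mulSingle (p.1 j) s) j
    have e2 := hq (Pi.mulSingle (p.1 j) s) j
    rw [Pi.mulSingle_eq_same] at e1
    rw [Pi.mulSingle_eq_of_ne (Ne.symm hne), map_one, e1] at e2
    exact hs (by simpa using e2)
  refine Prod.ext (Equiv.ext h1) ?_
  ext j s
  have e1 := hp (Pi.mulSingle (p.1 j) s) j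
  have e2 := hq (Pi.mulSingle (p.1 j) s) j
  rw [Pi.mulSingle_eq_same] at e1
  rw [← h1, Pi.mulSingle_eq_same] at e2
  exact e1.symm.trans e2

theorem aux_mat {A : Type} [Group A] {n k : ℕ} (ρ : A →* Matrix (Fin n) (Fin n) ℂ)
    (σ τ : Equiv.Perm (Fin k)) (a b : Fin k → A) :
    (Matrix.of fun f g : Fin k → Fin n => ∏ j, ρ (a j * b (σ j)) (f j) (g (τ (σ j)))) =
    (Matrix.of fun f g : Fin k → Fin n => ∏ j, ρ (a j) (f j) (g (σ j))) *
    (Matrix.of fun f g : Fin k → Fin n => ∏ j, ρ (b j) (f j) (g (τ j))) := by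
  ext f g
  simp only [Matrix.of_apply, Matrix.mul_apply, map_mul]
  rw [Fintype.prod_sum]
  refine (Fintype.sum_equiv (Equiv.arrowCongr σ (Equiv.refl (Fin n))) _ _ fun h => ?_)
  rw [← Equiv.prod_comp σ (fun j => ρ (b j) _ (g (τ j))), ← Finset.prod_mul_distrib]
  simp

theorem aux_rep {S : Type} [Group S] [Finite S] [IsSimpleGroup S]
    (hnab : ∃ a b : S, a * b ≠ b * a) (k n : ℕ)
    (ρ : MulAut S →* Matrix (Fin n) (Fin n) ℂ) :
    ∃ R : MulAut (Fin k → S) →* Matrix (Fin k → Fin n) (Fin k → Fin n) ℂ,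
      ∀ x, (R (MulAut.conj x)).trace = ∏ i, (ρ (MulAut.conj (x i))).trace := by
  classical
  choose p hp using fun φ => aux_exists_s13 (k := k) hnab φ
  have hone : p 1 = (1, 1) := aux_unique 1 _ _ (hp 1) (fun x j => rfl)
  have hmul : ∀ φ ψ, p (φ * ψ) =
      ((p φ).1.trans (p ψ).1, fun j => (p φ).2 j * (p ψ).2 ((p φ).1 j)) := by
    intro φ ψ
    refine aux_unique (φ * ψ) _ _ (hp _) (fun x j => ?_)
    show φ (ψ x) j = _
    rw [hp φ, hp ψ]; rfl
  have hconj : ∀ x, p (MulAut.conj x) = (1, fun j => MulAut.conj (x j)) := fun x =>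
    aux_unique _ _ _ (hp _) (fun y j => rfl)
  refine ⟨{ toFun := fun φ => Matrix.of fun f g => ∏ j, ρ ((p φ).2 j) (f j) (g ((p φ).1 j))
            map_one' := ?_
            map_mul' := ?_ }, ?_⟩
  · ext f g
    simp only [hone, Matrix.of_apply, Pi.one_apply, map_one, Equiv.Perm.one_apply, Matrix.one_apply]
    rw [Finset.prod_ite_zero]
    simp [funext_iff]
  · intro φ ψ
    rw [hmul φ ψ]
    exact aux_mat ρ _ _ _ _
  · intro x
    simp only [MonoidHom.coe_mk, OneHom.coe_mk, hconj, Matrix.trace, Matrix.diag, Matrix.of_apply,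
      Equiv.Perm.one_apply]
    rw [Fintype.prod_sum]

theorem stmt_13 (G S : Type) [Group G] [Fintype G] [Group S] [Fintype S]
    (hS : IsSimpleGroup S) (hnab : ∃ a b : S, a * b ≠ b * a)
    (M : Subgroup G) [M.Normal] (hMne : M ≠ ⊥)
    (hmin : ∀ N : Subgroup G, N.Normal → N ≤ M → N = ⊥ ∨ N = M)
    (k : ℕ) (e : ↥M ≃* (Fin k → S))
    (θ : FDRep ℂ S) (hθ : CategoryTheory.Simple θ)
    (hext : ∃ Ψ : FDRep ℂ (MulAut S), ∀ s : S, Ψ.character (MulAut.conj s) = θ.character s) :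
    ∃ Θ : FDRep ℂ G, CategoryTheory.Simple Θ ∧
      ∀ m : ↥M, Θ.character ↑m = ∏ i : Fin k, θ.character (e m i) := by
  classical
  obtain ⟨Ψ, hΨ⟩ := hext
  let b := Module.finBasis ℂ Ψ
  let ρ : MulAut S →* Matrix _ _ ℂ := (LinearMap.toMatrixAlgEquiv b).toMonoidHom.comp Ψ.ρ
  have hρ : ∀ s : S, (ρ (MulAut.conj s)).trace = θ.character s := by
    intro s
    rw [← hΨ]
    exact (LinearMap.trace_eq_matrix_trace ℂ b _).symm
  obtain ⟨R, hR⟩ := aux_rep hnab k _ ρ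
  let T : G →* (_ →ₗ[ℂ] _) := (Matrix.toLinAlgEquiv' (R := ℂ)).toMonoidHom.comp
    (R.comp ((MulAut.congr e).toMonoidHom.comp (MulAut.conjNormal (H := M))))
  have hT : ∀ m : M, (FDRep.of T).character (m : G) = ∏ i : Fin k, θ.character (e m i) := by
    intro m
    have h1 : MulAut.congr e (MulAut.conjNormal (m : G)) = MulAut.conj (e m) := by
      ext1 x
      show e (MulAut.conjNormal (m : G) (e.symm x)) = e m * x * (e m)⁻¹
      have : MulAut.conjNormal (m : G) (e.symm x) = m * e.symm x * m⁻¹ := rfl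
      rw [this]; simp
    show LinearMap.trace ℂ _ (Matrix.toLin' (R (MulAut.congr e (MulAut.conjNormal (m : G))))) = _
    rw [h1, Matrix.trace_toLin'_eq, hR]
    exact Finset.prod_congr rfl fun i _ => hρ _
  refine ⟨FDRep.of T, ?_, hT⟩
  apply aux_simple_s13 M
  rw [FDRep.simple_iff_char_is_norm_one]
  have hc : ∀ m : M, FDRep.character
      ((Action.res (FGModuleCat ℂ) M.subtype).obj (FDRep.of T)) m = ∏ i : Fin k, θ.character (e m i) := hT
  simp only [hc]
  have h1 := (FDRep.simple_iff_char_is_norm_one θ).1 hθ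
  calc _ = ∑ x : Fin k → S, ∏ i, (θ.character (x i) * θ.character (x i)⁻¹) := by
        refine Fintype.sum_equiv e.toEquiv _ _ fun m => ?_
        rw [Finset.prod_mul_distrib]; simp
    _ = ∏ i : Fin k, ∑ s : S, θ.character s * θ.character s⁻¹ := by
        rw [Fintype.prod_sum]
    _ = _ := by
        rw [h1, Nat.card_congr e.toEquiv]
        simp
end

section
/- Let G be a finite group with a minimal normal subgroup M = S₁ × ... × S_k where each S_i ≅ S is non-abelian simple. Suppose θ ∈ Irr(S) extends to Aut(S) and θ vanishes at s ∈ S. Then the element x = (s, 1, ..., 1) ∈ M is a vanishing element of G, and |s^S| divides |x^G|. -/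
open CategoryTheory in
lemma aux_char_one_ne {S : Type} [Group S] [Fintype S] (θ : FDRep ℂ S) (hθ : Simple θ) :
    θ.character 1 ≠ 0 := by
  intro h
  rw [FDRep.char_one, Nat.cast_eq_zero, Module.finrank_zero_iff] at h
  have h2 := (FDRep.simple_iff_char_is_norm_one θ).1 hθ
  have h3 : ∀ g, θ.character g = 0 := fun g => by
    have : θ.ρ g = 0 := LinearMap.ext fun v => Subsingleton.elim _ _
    rw [FDRep.character, this, map_zero]
  simp only [h3, mul_zero, Finset.sum_const_zero] at h2
  exact Nat.card_pos.ne' (Nat.cast_eq_zero.1 h2.symm)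

open CategoryTheory in
lemma aux_schur_s14 {S : Type} [Group S] [Fintype S] (θ : FDRep ℂ S) (hθ : Simple θ)
    (s : S) (hs : θ.character s = 0) (h : S) :
    ∑ t : S, θ.character (h * t * s * t⁻¹) = 0 := by
  set T : θ →ₗ[ℂ] θ := ∑ t : S, θ.ρ (t * s * t⁻¹) with hT
  have hcomm : ∀ g : S, T * θ.ρ g = θ.ρ g * T := by
    intro g
    rw [hT, Finset.sum_mul, Finset.mul_sum]
    refine (Fintype.sum_equiv (Equiv.mulLeft g) _ _ fun t => ?_).symm
    rw [← map_mul, ← map_mul]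
    congr 1
    simp [mul_assoc]
  let f : θ ⟶ θ := ⟨InducedCategory.homMk (ModuleCat.ofHom T), fun g => by
    ext1
    exact hcomm g⟩
  obtain ⟨c, hc⟩ := endomorphism_simple_eq_smul_id ℂ f
  have hcT : T = c • LinearMap.id := by
    have : f.hom.hom.hom = T := rfl
    rw [← this, ← hc]
    rfl
  have htr : LinearMap.trace ℂ θ T = 0 := by
    rw [hT, map_sum]
    refine Finset.sum_eq_zero fun t _ => ?_
    exact (θ.char_conj s t).trans hs
  have hc0 : c = 0 := by
    rw [hcT, map_smul, LinearMap.trace_id, smul_eq_mul, ← FDRep.char_one] at htr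
    exact (mul_eq_zero.1 htr).resolve_right (aux_char_one_ne θ hθ)
  have hT0 : T = 0 := by rw [hcT, hc0, zero_smul]
  have : ∑ t : S, θ.character (h * t * s * t⁻¹) = LinearMap.trace ℂ θ (θ.ρ h * T) := by
    rw [hT, Finset.mul_sum, map_sum]
    refine Finset.sum_congr rfl fun t _ => ?_
    rw [FDRep.character, ← map_mul]
    simp only [mul_assoc]
  rw [this, hT0, mul_zero, map_zero]

lemma aux_simple_s14 {G V : Type} [Group G] [Fintype G] [AddCommGroup V] [Module ℂ V]
    [FiniteDimensional ℂ V] (ρ : Representation ℂ G V) (h : ρ.IsIrreducible) :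
    CategoryTheory.Simple (FDRep.of ρ) := by
  rw [FDRep.simple_iff_char_is_norm_one]
  have hne : (Nat.card G : ℂ) ≠ 0 := by simp
  have := invertibleOfNonzero hne
  have h2 := Representation.char_orthonormal ρ ρ
  rw [if_pos ⟨Representation.Equiv.refl ρ⟩, inv_mul_eq_one₀ hne] at h2
  exact h2.symm

lemma aux_exists_s14 {G : Type} [Group G] [Fintype G] (x : G) (n : ℕ) :
    ∀ (V : Type) [AddCommGroup V] [Module ℂ V] [FiniteDimensional ℂ V]
    (ρ : Representation ℂ G V), Nontrivial V → Module.finrank ℂ V = n →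
    (∑ g : G, ρ (g * x * g⁻¹) = 0) → IsVanishing G x := by
  induction n using Nat.strong_induction_on with
  | _ n ih =>
  intro V _ _ _ ρ hV hn h0
  by_cases hirr : ρ.IsIrreducible
  · refine ⟨FDRep.of ρ, aux_simple_s14 ρ hirr, ?_⟩
    have h1 : ∑ g : G, LinearMap.trace ℂ V (ρ (g * x * g⁻¹)) = 0 := by
      rw [← map_sum, h0, map_zero]
    have h2 : ∀ g : G, LinearMap.trace ℂ V (ρ (g * x * g⁻¹)) = ρ.character x :=
      fun g => ρ.char_conj x g
    simp only [h2, Finset.sum_const, nsmul_eq_mul] at h1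
    exact (mul_eq_zero.1 h1).resolve_left (by simp)
  · have : ∃ W : Subrepresentation ρ, W ≠ ⊥ ∧ W ≠ ⊤ := by
      by_contra hcon
      push Not at hcon
      apply hirr
      have : Nontrivial (Subrepresentation ρ) := ⟨⊥, ⊤, fun h => by
        have h' : (⊥ : Submodule ℂ V) = ⊤ := congrArg Subrepresentation.toSubmodule h
        exact bot_ne_top h'⟩
      exact { eq_bot_or_eq_top := fun W => or_iff_not_imp_left.2 (hcon W) }
    obtain ⟨W, hb, ht⟩ := this
    have hb' : W.toSubmodule ≠ ⊥ := fun h => hb (Subrepresentation.toSubmodule_injective h)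
    have ht' : W.toSubmodule ≠ ⊤ := fun h => ht (Subrepresentation.toSubmodule_injective h)
    refine ih _ ?_ W.toSubmodule W.toRepresentation
      (Submodule.nontrivial_iff_ne_bot.2 hb') rfl ?_
    · rw [← hn]
      exact Submodule.finrank_lt ht'
    · ext v
      have := LinearMap.congr_fun h0 v.1
      simp only [LinearMap.sum_apply, LinearMap.zero_apply] at this
      simp only [LinearMap.sum_apply, LinearMap.zero_apply, Submodule.coe_sum,
        Submodule.coe_zero]
      exact this

/-- Right regular representation on functions. -/
def auxReg (G : Type) [Group G] : Representation ℂ G (G → ℂ) where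
  toFun g := LinearMap.funLeft ℂ ℂ (fun h => h * g)
  map_one' := by ext; simp [LinearMap.funLeft]
  map_mul' a b := by ext; simp [LinearMap.funLeft, mul_assoc]

lemma auxReg_apply {G : Type} [Group G] (g : G) (u : G → ℂ) (h : G) :
    auxReg G g u h = u (h * g) := rfl

lemma aux_van {G : Type} [Group G] [Fintype G] (x : G) (u : G → ℂ) (hu : u ≠ 0)
    (h : ∀ h, ∑ g : G, u (h * (g * x * g⁻¹)) = 0) : IsVanishing G x := by
  set T : Module.End ℂ (G → ℂ) := ∑ g : G, auxReg G (g * x * g⁻¹) with hT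
  have hcomm : ∀ g : G, T * auxReg G g = auxReg G g * T := by
    intro g
    rw [hT, Finset.sum_mul, Finset.mul_sum]
    refine (Fintype.sum_equiv (Equiv.mulLeft g) _ _ fun t => ?_).symm
    rw [← map_mul, ← map_mul]
    congr 1
    simp [mul_assoc]
  have huT : T u = 0 := by
    ext a
    simp only [hT, LinearMap.sum_apply, Finset.sum_apply, auxReg_apply]
    exact h a
  let W : Subrepresentation (auxReg G) := ⟨LinearMap.ker T, fun g v hv => by
    rw [LinearMap.mem_ker] at hv ⊢
    have := LinearMap.congr_fun (hcomm g) v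
    simp only [Module.End.mul_apply] at this
    rw [this, hv, map_zero]⟩
  refine aux_exists_s14 x _ W.toSubmodule W.toRepresentation ?_ rfl ?_
  · exact ⟨⟨⟨u, huT⟩, 0, fun h => hu (congrArg Subtype.val h)⟩⟩
  · apply LinearMap.ext
    intro v
    apply Subtype.ext
    have hv : T v.1 = 0 := v.2
    simp only [hT, LinearMap.sum_apply] at hv
    simp only [LinearMap.sum_apply, LinearMap.zero_apply, Submodule.coe_sum,
        Submodule.coe_zero]
    exact hv

lemma aux_coord {S : Type} [Group S] [Fintype S] (hS : IsSimpleGroup S) {k : ℕ}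
    (φ : MulAut (Fin k → S)) (i : Fin k) :
    ∃ (j : Fin k) (α : MulAut S), ∀ s, φ (Pi.mulSingle i s) j = α s := by
  let f : Fin k → S →* S := fun j =>
    (Pi.evalMonoidHom (fun _ => S) j).comp (φ.toMonoidHom.comp (MonoidHom.mulSingle (fun _ => S) i))
  have hf : ∀ j s, f j s = φ (Pi.mulSingle i s) j := fun _ _ => rfl
  obtain ⟨a, ha⟩ := exists_ne (1 : S)
  have : ∃ j, f j a ≠ 1 := by
    by_contra hcon
    push Not at hcon
    apply ha
    have : φ (Pi.mulSingle i a) = 1 := funext fun j => hcon j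
    rw [map_eq_one_iff φ φ.injective] at this
    simpa using this
  obtain ⟨j, hj⟩ := this
  have hker : (f j).ker = ⊥ := by
    refine ((MonoidHom.normal_ker (f j)).eq_bot_or_eq_top).resolve_right fun h => hj ?_
    have : a ∈ (f j).ker := h ▸ Subgroup.mem_top a
    exact this
  have hinj := (MonoidHom.ker_eq_bot_iff (f j)).1 hker
  exact ⟨j, MulEquiv.ofBijective (f j) (Finite.injective_iff_bijective.1 hinj), fun s => rfl⟩

lemma aux_class {G : Type*} [Group G] (x : G) :
    classSize x = (Subgroup.centralizer {x}).index := by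
  have h : (Subgroup.centralizer {x}).index = (MulAction.stabilizer (ConjAct G) x).index := by
    have h2 : (MulAction.stabilizer (ConjAct G) x).comap
        (ConjAct.toConjAct : G ≃* ConjAct G).toMonoidHom = Subgroup.centralizer {x} := by
      ext g
      rw [Subgroup.mem_comap, Subgroup.mem_centralizer_singleton_iff, MulAction.mem_stabilizer_iff]
      exact mul_inv_eq_iff_eq_mul
    rw [← h2]
    exact Subgroup.index_comap_of_surjective _ ConjAct.toConjAct.surjective
  rw [h, MulAction.index_stabilizer, ← Nat.card_coe_set_eq, classSize]
  refine Nat.card_congr (Equiv.subtypeEquivRight fun y => ?_)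
  rw [ConjAct.mem_orbit_conjAct, isConj_comm]

lemma aux_dvd_s14 {G : Type*} [Group G] (M H : Subgroup G) [M.Normal] [Finite G] :
    H.relIndex M ∣ H.index := by
  have h1 := Subgroup.relIndex_dvd_index_of_le (le_sup_left : H ≤ H ⊔ M)
  have h2 : H.relIndex (H ⊔ M) = H.relIndex M := by
    have a := Subgroup.relIndex_sup_right H M
    have b := Subgroup.relIndex_mul_relIndex (H ⊓ M) H (H ⊔ M) inf_le_left le_sup_left
    have c := Subgroup.relIndex_mul_relIndex (H ⊓ M) M (H ⊔ M) inf_le_right le_sup_right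
    rw [Subgroup.inf_relIndex_left] at b
    rw [Subgroup.inf_relIndex_right, a, ← b, mul_comm] at c
    have hne : M.relIndex H ≠ 0 := Subgroup.index_ne_zero_of_finite
    exact (Nat.eq_of_mul_eq_mul_left (Nat.pos_of_ne_zero hne) c).symm
  rwa [h2] at h1

theorem stmt_14 (G S : Type) [Group G] [Fintype G] [Group S] [Fintype S]
    (hS : IsSimpleGroup S) (hnab : ∃ a b : S, a * b ≠ b * a)
    (M : Subgroup G) [M.Normal] (hMne : M ≠ ⊥)
    (hmin : ∀ N : Subgroup G, N.Normal → N ≤ M → N = ⊥ ∨ N = M)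
    (k : ℕ) (hk : 0 < k) (e : ↥M ≃* (Fin k → S))
    (θ : FDRep ℂ S) (hθ : CategoryTheory.Simple θ)
    (hext : ∃ Ψ : FDRep ℂ (MulAut S), ∀ s : S, Ψ.character (MulAut.conj s) = θ.character s)
    (s : S) (hvan : θ.character s = 0) :
    IsVanishing G ↑(e.symm fun i => if i = (⟨0, hk⟩ : Fin k) then s else 1) ∧
    classSize s ∣ classSize (↑(e.symm fun i => if i = (⟨0, hk⟩ : Fin k) then s else 1) : G) := by
  have hx : (fun i => if i = (⟨0, hk⟩ : Fin k) then s else 1) = Pi.mulSingle (⟨0, hk⟩ : Fin k) s := by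
    ext i
    simp [Pi.mulSingle_apply]
  rw [hx]
  set i₀ : Fin k := ⟨0, hk⟩
  set x : M := e.symm (Pi.mulSingle i₀ s) with hxdef
  have hex : e x = Pi.mulSingle i₀ s := by simp [x]
  constructor
  · classical
    let F : M → ℂ := fun m => ∏ i, θ.character (e m i)
    let u : G → ℂ := fun g => if h : g ∈ M then F ⟨g, h⟩ else 0
    have huM : ∀ m : M, u m = F m := fun m => by simp [u]
    have hunM : ∀ g, g ∉ M → u g = 0 := fun g hg => by simp [u, hg]
    -- class sums over M
    have key : ∀ (g : G) (h : G), ∑ m : M, u (h * (m * (g * x * g⁻¹) * (m : G)⁻¹)) = 0 := by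
      intro g h
      let y : M := MulAut.conjNormal g x
      have hy : (y : G) = g * x * g⁻¹ := MulAut.conjNormal_apply g x
      rw [← hy]
      by_cases hh : h ∈ M
      · lift h to M using hh
        obtain ⟨j, α, hα⟩ := aux_coord hS
          ((e.symm.trans (MulAut.conjNormal g : MulAut M)).trans e) i₀
        have hyj : e y j = α s := hα s
        obtain ⟨Ψ, hΨ⟩ := hext
        have hs' : θ.character (α s) = 0 := by
          rw [← hΨ, ← hvan, ← hΨ s, ← Ψ.char_conj (MulAut.conj s) α]
          congr 1
          ext t
          simp
        have h1 : ∀ m : M, u (h * (m * y * (m : G)⁻¹)) =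
            ∏ i, θ.character (e h i * e m i * e y i * (e m i)⁻¹) := by
          intro m
          have := huM (h * (m * y * m⁻¹))
          push_cast at this
          rw [this]
          simp [F, mul_assoc]
        simp only [h1]
        refine (Fintype.sum_equiv e.toEquiv _ (fun p : Fin k → S =>
          ∏ i, θ.character (e h i * p i * e y i * (p i)⁻¹)) (fun _ => rfl)).trans ?_
        have h2 := Finset.prod_univ_sum (fun _ : Fin k => (Finset.univ : Finset S))
          (fun i t => θ.character (e h i * t * e y i * t⁻¹))
        rw [Fintype.piFinset_univ] at h2
        rw [← h2]
        refine Finset.prod_eq_zero (Finset.mem_univ j) ?_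
        rw [hyj]
        exact aux_schur_s14 θ hθ _ hs' _
      · refine Finset.sum_eq_zero fun m _ => hunM _ fun hc => hh ?_
        have : (m * y * (m : G)⁻¹) ∈ M := (m * y * m⁻¹).2
        exact (M.mul_mem_cancel_right this).1 hc
    refine aux_van (x : G) u ?_ ?_
    · intro h0
      have := huM 1
      rw [h0] at this
      simp only [F, map_one, Pi.one_apply, Pi.zero_apply, Finset.prod_const] at this
      exact pow_ne_zero _ (aux_char_one_ne θ hθ) this.symm
    · intro h
      have h1 : ∀ m : M, ∑ g : G, u (h * (m * (g * x * g⁻¹) * (m : G)⁻¹)) =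
          ∑ g : G, u (h * (g * x * g⁻¹)) := by
        intro m
        refine Fintype.sum_equiv (Equiv.mulLeft (m : G)) _ _ fun g => ?_
        simp [mul_assoc]
      have h2 : ∑ m : M, ∑ g : G, u (h * (m * (g * x * g⁻¹) * (m : G)⁻¹)) = 0 := by
        rw [Finset.sum_comm]
        exact Finset.sum_eq_zero fun g _ => key g h
      simp only [h1, Finset.sum_const, nsmul_eq_mul] at h2
      exact (mul_eq_zero.1 h2).resolve_left (by simp)
  · rw [aux_class, aux_class]
    refine dvd_trans (dvd_of_eq ?_) (aux_dvd_s14 M _)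
    let f : M →* S := (Pi.evalMonoidHom (fun _ => S) i₀).comp e.toMonoidHom
    have hf : Function.Surjective f := fun t => ⟨e.symm (Pi.mulSingle i₀ t), by simp [f]⟩
    rw [← Subgroup.index_comap_of_surjective _ hf, Subgroup.relIndex]
    congr 1
    ext m
    rw [Subgroup.mem_comap, Subgroup.mem_subgroupOf, Subgroup.mem_centralizer_singleton_iff,
      Subgroup.mem_centralizer_singleton_iff]
    have h1 : (m : G) * x = x * m ↔ e m * e x = e x * e m := by
      rw [← map_mul, ← map_mul, e.injective.eq_iff, Subtype.ext_iff]
      rfl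
    rw [h1, hex, funext_iff]
    constructor
    · intro h i
      by_cases hi : i = i₀
      · subst hi
        simpa [f] using h
      · simp [hi]
    · intro h
      simpa [f] using h i₀
end
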